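/- Let α > 0 be irrational and satisfy condition (*). Let a < b be reals and let h : ℝ → ℝ be continuous with h = 0 outside [a,b] and h > 0 on (a,b). Assume h is twice differentiable on (a,b) and h″ is uniformly bounded on (a,b). Let u = (1,α)/√(1+α²), v = (−α,1)/√(1+α²), and let ω = ∑_{g∈ℤ²} h(⟨g,v⟩)·δ_{⟨g,u⟩} be the associated weighted Dirac comb on ℝ. Then ω is bounded distance equivalent to m·λ, where λ is Lebesgue measure on ℝ and m = ∫_a^b h(t) dt. -/

import Mathlib

open MeasureTheory

/-- The Gauss map `x ↦ 1/{x}`. -/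
noncomputable def gaussMap (x : ℝ) : ℝ := (Int.fract x)⁻¹

/-- The partial quotients `a_n` of the continued fraction expansion of `α`. -/
noncomputable def cfA (α : ℝ) (n : ℕ) : ℤ := ⌊gaussMap^[n] α⌋

/-- The convergent denominators `q_n` of the continued fraction expansion of `α`:
`q₀ = 1`, `q₁ = a₁`, `q_{n+2} = a_{n+2} q_{n+1} + q_n`. -/
noncomputable def cfQ (α : ℝ) : ℕ → ℝ
  | 0 => 1
  | 1 => (cfA α 1 : ℝ)
  | (n + 2) => (cfA α (n + 2) : ℝ) * cfQ α (n + 1) + cfQ α n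

/-- Condition (*) from Grepstad–Larcher:
`∑_{ℓ=0}^m a_{ℓ+1} q_ℓ^{-1/2} ∑_{k=1}^{ℓ+1} a_k` is bounded uniformly in `m`. -/
def CondStar (α : ℝ) : Prop :=
  ∃ C > 0, ∀ m : ℕ,
    ∑ ℓ ∈ Finset.range (m + 1),
      ((cfA α (ℓ + 1) : ℝ) / Real.sqrt (cfQ α ℓ)) *
        ∑ k ∈ Finset.Icc 1 (ℓ + 1), (cfA α k : ℝ) < C

/-- Bounded distance equivalence of measures on `ℝ`. -/
def BddDistMeasures (μ ν : Measure ℝ) : Prop :=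
  ∃ C > 0, ∀ a b : ℝ, a < b →
    |(μ (Set.Icc a b)).toReal - (ν (Set.Icc a b)).toReal| < C

section ContinuedFraction

variable {α : ℝ}

theorem irrational_iterate_gaussMap (hα : Irrational α) (n : ℕ) :
    Irrational (gaussMap^[n] α) := by
  induction n with
  | zero => simpa using hα
  | succ n ih =>
    rw [Function.iterate_succ_apply', gaussMap]
    refine Irrational.inv ?_
    rw [Int.fract]
    exact ih.sub_intCast _

theorem iterate_gaussMap_eq (α : ℝ) (n : ℕ) :
    gaussMap^[n] α = cfA α n + (gaussMap^[n + 1] α)⁻¹ := by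
  rw [Function.iterate_succ_apply', gaussMap, inv_inv, cfA, Int.floor_add_fract]

theorem one_lt_iterate_gaussMap_succ (hα : Irrational α) (n : ℕ) :
    1 < gaussMap^[n + 1] α := by
  rw [Function.iterate_succ_apply', gaussMap]
  have h1 : Int.fract (gaussMap^[n] α) ≠ 0 := by
    rw [Int.fract]
    exact ((irrational_iterate_gaussMap hα n).sub_intCast _).ne_zero
  have h0 := lt_of_le_of_ne (Int.fract_nonneg (gaussMap^[n] α)) h1.symm
  exact (one_lt_inv₀ h0).2 (Int.fract_lt_one _)

theorem one_le_cfA_succ (hα : Irrational α) (n : ℕ) : 1 ≤ cfA α (n + 1) := by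
  rw [cfA, Int.le_floor]
  exact_mod_cast (one_lt_iterate_gaussMap_succ hα n).le

theorem one_le_cfA_succ_real (hα : Irrational α) (n : ℕ) : (1 : ℝ) ≤ cfA α (n + 1) := by
  exact_mod_cast one_le_cfA_succ hα n

theorem one_le_cfQ (hα : Irrational α) (n : ℕ) : 1 ≤ cfQ α n := by
  induction n using Nat.strong_induction_on with
  | _ n ih =>
    match n with
    | 0 => simp [cfQ]
    | 1 => simpa [cfQ] using one_le_cfA_succ_real hα 0
    | n + 2 =>
      have h1 := ih n (by omega)
      have h2 := ih (n + 1) (by omega)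
      have h3 := one_le_cfA_succ_real hα (n + 1)
      rw [cfQ]
      nlinarith

theorem natCast_le_cfQ (hα : Irrational α) (n : ℕ) : (n : ℝ) ≤ cfQ α n := by
  induction n with
  | zero => simp [cfQ]
  | succ n ih =>
    cases n with
    | zero => simpa using one_le_cfQ hα 1
    | succ n =>
      have h1 := one_le_cfQ hα n
      have h2 := one_le_cfQ hα (n + 1)
      have h3 := one_le_cfA_succ_real hα (n + 1)
      rw [cfQ]
      push_cast at ih ⊢
      nlinarith

theorem exists_intCast_eq_cfQ (α : ℝ) (n : ℕ) : ∃ q : ℤ, cfQ α n = q := by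
  induction n using Nat.strong_induction_on with
  | _ n ih =>
    match n with
    | 0 => exact ⟨1, by simp [cfQ]⟩
    | 1 => exact ⟨cfA α 1, by simp [cfQ]⟩
    | n + 2 =>
      obtain ⟨q, hq⟩ := ih n (by omega)
      obtain ⟨r, hr⟩ := ih (n + 1) (by omega)
      exact ⟨cfA α (n + 2) * r + q, by rw [cfQ, hq, hr]; push_cast; ring⟩

/-- The product of the first `n` complete quotients after the integer part. -/
noncomputable def cfProd (α : ℝ) (n : ℕ) : ℝ := ∏ i ∈ Finset.range n, gaussMap^[i + 1] α

theorem cfProd_succ (α : ℝ) (n : ℕ) :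
    cfProd α (n + 1) = cfProd α n * gaussMap^[n + 1] α := by
  rw [cfProd, Finset.prod_range_succ, cfProd]

theorem cfProd_pos (hα : Irrational α) (n : ℕ) : 0 < cfProd α n :=
  Finset.prod_pos fun i _ => one_pos.trans (one_lt_iterate_gaussMap_succ hα i)

theorem cfProd_add_two (hα : Irrational α) (n : ℕ) :
    cfProd α (n + 2) = gaussMap^[n + 2] α * cfQ α (n + 1) + cfQ α n := by
  induction n with
  | zero =>
    have h1 : gaussMap^[1] α = cfA α 1 + (gaussMap^[2] α)⁻¹ := iterate_gaussMap_eq α 1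
    have h2 : 1 < gaussMap^[2] α := one_lt_iterate_gaussMap_succ hα 1
    have h3 : cfProd α (0 + 2) = gaussMap^[1] α * gaussMap^[2] α := by
      simp [cfProd, Finset.prod_range_succ]
    rw [h3, h1]
    simp only [cfQ]
    field_simp
  | succ n ih =>
    have h1 := iterate_gaussMap_eq α (n + 2)
    have h2 := one_lt_iterate_gaussMap_succ hα (n + 2)
    rw [cfProd_succ, ih, cfQ, h1]
    field_simp
    ring

theorem cfQ_le_cfProd (hα : Irrational α) (n : ℕ) : cfQ α n ≤ cfProd α n := by
  match n with
  | 0 => simp [cfQ, cfProd]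
  | 1 =>
    simp only [cfQ, cfProd, Finset.range_one, Finset.prod_singleton, cfA]
    exact Int.floor_le _
  | n + 2 =>
    rw [cfProd_add_two hα, cfQ]
    have h1 := one_le_cfQ hα (n + 1)
    have h2 : (cfA α (n + 2) : ℝ) ≤ gaussMap^[n + 2] α := Int.floor_le _
    nlinarith

theorem exists_cfQ_mul_sub_eq (hα : Irrational α) (n : ℕ) :
    ∃ p : ℤ, cfQ α n * α - p = (-1) ^ n / cfProd α (n + 1) := by
  induction n using Nat.strong_induction_on with
  | _ n ih =>
    match n with
    | 0 =>
      refine ⟨cfA α 0, ?_⟩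
      have h0 : α = cfA α 0 + (gaussMap^[1] α)⁻¹ := iterate_gaussMap_eq α 0
      have h1 : cfProd α (0 + 1) = gaussMap^[1] α := by simp [cfProd]
      rw [h1, cfQ, one_mul, pow_zero, one_div]
      linarith
    | 1 =>
      refine ⟨cfA α 1 * cfA α 0 + 1, ?_⟩
      have h0 : α = cfA α 0 + (gaussMap^[1] α)⁻¹ := iterate_gaussMap_eq α 0
      have h1 : gaussMap^[1] α = cfA α 1 + (gaussMap^[2] α)⁻¹ := iterate_gaussMap_eq α 1
      have h2 : 1 < gaussMap^[1] α := one_lt_iterate_gaussMap_succ hα 0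
      have h3 : 1 < gaussMap^[2] α := one_lt_iterate_gaussMap_succ hα 1
      have h4 : cfProd α (1 + 1) = gaussMap^[1] α * gaussMap^[2] α := by
        simp [cfProd, Finset.prod_range_succ]
      have h5 : (cfA α 1 : ℝ) = gaussMap^[1] α - (gaussMap^[2] α)⁻¹ := by linarith
      have h6 : cfQ α 1 * α - ((cfA α 1 * cfA α 0 + 1 : ℤ) : ℝ) =
          cfA α 1 * (α - cfA α 0) - 1 := by
        rw [cfQ]; push_cast; ring
      have h7 : α - cfA α 0 = (gaussMap^[1] α)⁻¹ := by linarith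
      rw [h6, h7, h4, h5]
      field_simp
      ring
    | n + 2 =>
      obtain ⟨p, hp⟩ := ih n (by omega)
      obtain ⟨r, hr⟩ := ih (n + 1) (by omega)
      refine ⟨cfA α (n + 2) * r + p, ?_⟩
      have h1 := iterate_gaussMap_eq α (n + 2)
      have h2 := one_lt_iterate_gaussMap_succ hα (n + 1)
      have h3 := one_lt_iterate_gaussMap_succ hα (n + 2)
      have hT := cfProd_pos hα (n + 1)
      have h4 : (cfA α (n + 2) : ℝ) = gaussMap^[n + 2] α - (gaussMap^[n + 3] α)⁻¹ := by
        linarith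
      have h5 : cfQ α (n + 2) * α - ((cfA α (n + 2) * r + p : ℤ) : ℝ) =
          cfA α (n + 2) * (cfQ α (n + 1) * α - r) + (cfQ α n * α - p) := by
        rw [cfQ]; push_cast; ring
      rw [h5, hp, hr, cfProd_succ α (n + 2), cfProd_succ α (n + 1), h4]
      simp only [add_assoc, Nat.reduceAdd] at h2 h3 ⊢
      field_simp
      ring

theorem CondStar.exists_cfA_pow_le (hα : Irrational α) (h : CondStar α) :
    ∃ C > 0, ∀ n, (cfA α (n + 1) : ℝ) ^ 4 ≤ C * cfQ α n := by
  obtain ⟨C, hC, hsum⟩ := h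
  refine ⟨C ^ 2, by positivity, fun n => ?_⟩
  have hq := one_le_cfQ hα n
  have hs : 0 < Real.sqrt (cfQ α n) := Real.sqrt_pos.2 (by linarith)
  have ha : ∀ k ≥ 1, (0 : ℝ) ≤ cfA α k := by
    intro k hk
    obtain ⟨j, rfl⟩ := Nat.exists_eq_add_of_le' hk
    linarith [one_le_cfA_succ_real hα j]
  have hin : ∀ l : ℕ, 0 ≤ ∑ k ∈ Finset.Icc 1 (l + 1), (cfA α k : ℝ) := fun l =>
    Finset.sum_nonneg fun k hk => ha k (Finset.mem_Icc.1 hk).1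
  have h1 : ((cfA α (n + 1) : ℝ) / Real.sqrt (cfQ α n)) *
      ∑ k ∈ Finset.Icc 1 (n + 1), (cfA α k : ℝ) ≤ C := by
    refine le_trans ?_ (hsum n).le
    refine Finset.single_le_sum (f := fun l => ((cfA α (l + 1) : ℝ) / Real.sqrt (cfQ α l)) *
      ∑ k ∈ Finset.Icc 1 (l + 1), (cfA α k : ℝ)) (fun l _ => ?_) (Finset.self_mem_range_succ n)
    exact mul_nonneg (div_nonneg (ha _ (by omega)) (Real.sqrt_nonneg _)) (hin l)
  have h2 : (cfA α (n + 1) : ℝ) ≤ ∑ k ∈ Finset.Icc 1 (n + 1), (cfA α k : ℝ) :=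
    Finset.single_le_sum (f := fun k => (cfA α k : ℝ))
      (fun k hk => ha k (Finset.mem_Icc.1 hk).1) (by simp)
  have h3 := ha (n + 1) (by omega)
  have h4 : (cfA α (n + 1) : ℝ) ^ 2 ≤ C * Real.sqrt (cfQ α n) := by
    have : ((cfA α (n + 1) : ℝ) / Real.sqrt (cfQ α n)) * cfA α (n + 1) ≤ C :=
      (mul_le_mul_of_nonneg_left h2 (by positivity)).trans h1
    rw [div_mul_eq_mul_div, div_le_iff₀ hs] at this
    nlinarith
  calc (cfA α (n + 1) : ℝ) ^ 4 = ((cfA α (n + 1) : ℝ) ^ 2) ^ 2 := by ring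
    _ ≤ (C * Real.sqrt (cfQ α n)) ^ 2 := by gcongr
    _ = C ^ 2 * cfQ α n := by rw [mul_pow, Real.sq_sqrt (by linarith)]

/-- Condition (*) forces `|kα - p| ≥ c k^(-5/4)`. -/
theorem CondStar.exists_le_abs_mul_sub_pow (hα : Irrational α) (h : CondStar α) :
    ∃ c > 0, ∀ k : ℕ, 1 ≤ k → ∀ p : ℤ, c ≤ |k * α - p| ^ 4 * (k : ℝ) ^ 5 := by
  obtain ⟨C, hC, hA⟩ := h.exists_cfA_pow_le hα
  refine ⟨min (1 / 256) (1 / (8192 * C)), by positivity, fun k hk p => ?_⟩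
  have hk' : (1 : ℝ) ≤ k := by exact_mod_cast hk
  have hex : ∃ n, 2 * (k : ℝ) ≤ cfProd α (n + 1) := by
    refine ⟨2 * k, (natCast_le_cfQ hα _).trans' ?_ |>.trans (cfQ_le_cfProd hα _)⟩
    push_cast
    linarith
  classical
  obtain ⟨n, hn, hmin⟩ : ∃ n, 2 * (k : ℝ) ≤ cfProd α (n + 1) ∧ cfProd α n < 2 * k := by
    refine ⟨Nat.find hex, Nat.find_spec hex, ?_⟩
    rcases hN : Nat.find hex with _ | m
    · simp only [cfProd, Finset.range_zero, Finset.prod_empty]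
      linarith
    · exact not_le.1 (Nat.find_min hex (m := m) (by omega))
  obtain ⟨P, hP⟩ := exists_cfQ_mul_sub_eq hα n
  obtain ⟨Q, hQ⟩ := exists_intCast_eq_cfQ α n
  have hT := cfProd_pos hα (n + 1)
  have hq := one_le_cfQ hα n
  have hqT := cfQ_le_cfProd hα n
  have hD : |cfQ α n * α - P| = 1 / cfProd α (n + 1) := by
    rw [hP, abs_div, abs_pow, abs_neg, abs_one, one_pow, abs_of_pos hT]
  have hkey : cfQ α n * (k * α - p) - k * (cfQ α n * α - P) = k * P - p * cfQ α n := by ring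
  have hq0 : 0 < cfQ α n := by linarith
  by_cases hcase : (k : ℤ) * P = p * Q
  · refine (min_le_right _ _).trans ?_
    have h0 : (k : ℝ) * P - p * cfQ α n = 0 := by
      rw [hQ, sub_eq_zero]; exact_mod_cast hcase
    rw [h0, sub_eq_zero] at hkey
    have h1 : cfQ α n * |k * α - p| = k * (1 / cfProd α (n + 1)) := by
      rw [← hD]
      have := congrArg abs hkey
      rwa [abs_mul, abs_mul, abs_of_pos hq0, Nat.abs_cast] at this
    have ha := one_le_cfA_succ_real hα n
    have hTle : cfProd α (n + 1) ≤ 4 * cfA α (n + 1) * k := by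
      rw [cfProd_succ]
      have h2 : gaussMap^[n + 1] α ≤ 2 * cfA α (n + 1) := by
        have : gaussMap^[n + 1] α < cfA α (n + 1) + 1 := Int.lt_floor_add_one _
        linarith
      have h3 := one_lt_iterate_gaussMap_succ hα n
      calc cfProd α n * gaussMap^[n + 1] α ≤ (2 * k) * (2 * cfA α (n + 1)) := by gcongr
        _ = _ := by ring
    have h4 : 1 / (8 * cfA α (n + 1) * k) ≤ |k * α - p| := by
      have h5 : |k * α - p| = k * (1 / cfProd α (n + 1)) / cfQ α n := by
        rw [← h1]; field_simp
      rw [h5, mul_one_div, div_div, div_le_div_iff₀ (by positivity) (by positivity), one_mul]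
      calc cfProd α (n + 1) * cfQ α n ≤ (4 * cfA α (n + 1) * k) * (2 * k) := by
            gcongr; linarith
        _ = _ := by ring
    have h6 : (1 / (8 * cfA α (n + 1) * k : ℝ)) ^ 4 * (k : ℝ) ^ 5
        = k / (4096 * (cfA α (n + 1) : ℝ) ^ 4) := by
      field_simp; norm_num
    calc 1 / (8192 * C) ≤ k / (4096 * (cfA α (n + 1) : ℝ) ^ 4) := by
          rw [div_le_div_iff₀ (by positivity) (by positivity)]
          have := hA n
          nlinarith
      _ = (1 / (8 * cfA α (n + 1) * k : ℝ)) ^ 4 * (k : ℝ) ^ 5 := h6.symm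
      _ ≤ _ := by gcongr
  · refine (min_le_left _ _).trans ?_
    have h0 : (1 : ℝ) ≤ |(k : ℝ) * P - p * cfQ α n| := by
      rw [hQ]
      have : (1 : ℤ) ≤ |(k : ℤ) * P - p * Q| := Int.one_le_abs (sub_ne_zero.2 hcase)
      exact_mod_cast this
    have h1 : (1 : ℝ) ≤ cfQ α n * |k * α - p| + k * |cfQ α n * α - P| := by
      rw [← hkey] at h0
      refine h0.trans ((abs_sub _ _).trans ?_)
      rw [abs_mul, abs_mul, abs_of_pos hq0, Nat.abs_cast]
    have h2 : k * |cfQ α n * α - P| ≤ 1 / 2 := by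
      rw [hD, mul_one_div, div_le_div_iff₀ hT two_pos]
      linarith
    have h3 : 1 / (4 * k : ℝ) ≤ |k * α - p| := by
      rw [div_le_iff₀ (by positivity)]
      have := abs_nonneg (k * α - p)
      nlinarith
    calc (1 / 256 : ℝ) ≤ (1 / (4 * k : ℝ)) ^ 4 * (k : ℝ) ^ 5 := by
          have : (1 / (4 * k : ℝ)) ^ 4 * (k : ℝ) ^ 5 = k / 256 := by field_simp; norm_num
          rw [this]; linarith
      _ ≤ _ := by gcongr

end ContinuedFraction

section SmallDenominators

theorem sum_one_div_sq_le_of_separated {ι : Type*} (s : Finset ι) (x : ι → ℝ) {δ : ℝ}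
    (hδ : 0 < δ) (h0 : ∀ i ∈ s, δ ≤ |x i|)
    (hsep : ∀ i ∈ s, ∀ j ∈ s, i ≠ j → δ ≤ |x i - x j|) :
    ∑ i ∈ s, 1 / x i ^ 2 ≤ 4 / δ ^ 2 * ∑' j : ℤ, 1 / (j : ℝ) ^ 2 := by
  classical
  have hsummable : Summable fun j : ℤ => 1 / (j : ℝ) ^ 2 :=
    Real.summable_one_div_int_pow.2 one_lt_two
  have hinj : Set.InjOn (fun i => ⌊x i / δ⌋) s := by
    intro i hi j hj hij
    by_contra hne
    have h1 := Int.abs_sub_lt_one_of_floor_eq_floor hij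
    rw [← sub_div, abs_div, abs_of_pos hδ, div_lt_one hδ] at h1
    exact absurd (hsep i hi j hj hne) (not_le.2 h1)
  have hterm : ∀ i ∈ s, 1 / x i ^ 2 ≤ 4 / δ ^ 2 * (1 / (⌊x i / δ⌋ : ℝ) ^ 2) := by
    intro i hi
    obtain ⟨y, hy⟩ : ∃ y, y = x i / δ := ⟨_, rfl⟩
    have hxi : x i = δ * y := by rw [hy]; field_simp
    have hy1 : 1 ≤ |y| := by
      rw [hy, abs_div, abs_of_pos hδ, one_le_div hδ]
      exact h0 i hi
    have hfl : |(⌊y⌋ : ℝ)| ≤ 2 * |y| ∧ (⌊y⌋ : ℝ) ≠ 0 := by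
      have l1 := Int.floor_le y
      have l2 := Int.lt_floor_add_one y
      rcases le_abs.1 hy1 with h | h
      · have : (1 : ℝ) ≤ ⌊y⌋ := by exact_mod_cast Int.le_floor.2 (by exact_mod_cast h)
        refine ⟨?_, by linarith⟩
        rw [abs_of_nonneg (by linarith), abs_of_nonneg (by linarith)]
        linarith
      · refine ⟨?_, by linarith⟩
        rw [abs_of_nonpos (by linarith), abs_of_nonpos (by linarith)]
        linarith
    have hsq : (⌊y⌋ : ℝ) ^ 2 ≤ 4 * y ^ 2 := by
      have := pow_le_pow_left₀ (abs_nonneg _) hfl.1 2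
      rw [sq_abs, mul_pow, sq_abs] at this
      linarith
    have hf2 : 0 < (⌊y⌋ : ℝ) ^ 2 := by have := hfl.2; positivity
    have hy2 : 0 < y ^ 2 := by linarith
    have hδ2 : 0 < δ ^ 2 := by positivity
    rw [← hy, hxi, div_mul_div_comm, mul_pow,
      div_le_div_iff₀ (mul_pos hδ2 hy2) (mul_pos hδ2 hf2)]
    nlinarith
  calc ∑ i ∈ s, 1 / x i ^ 2 ≤ ∑ i ∈ s, 4 / δ ^ 2 * (1 / (⌊x i / δ⌋ : ℝ) ^ 2) :=
        Finset.sum_le_sum hterm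
    _ = 4 / δ ^ 2 * ∑ j ∈ s.image (fun i => ⌊x i / δ⌋), 1 / (j : ℝ) ^ 2 := by
        rw [Finset.sum_image hinj, Finset.mul_sum]
    _ ≤ _ := by
        gcongr
        exact hsummable.sum_le_tsum _ fun j _ => by positivity

theorem summable_of_sum_dyadic_le {f g : ℕ → ℝ} (hf : ∀ n, 0 ≤ f n)
    (hfg : ∀ j, ∑ k ∈ Finset.Ico (2 ^ j) (2 ^ (j + 1)), f k ≤ g j) (hg : Summable g) :
    Summable f := by
  have hg0 : ∀ j, 0 ≤ g j := fun j => (Finset.sum_nonneg fun k _ => hf k).trans (hfg j)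
  have hdy : ∀ J, ∑ k ∈ Finset.range (2 ^ J), f k ≤ f 0 + ∑ j ∈ Finset.range J, g j := by
    intro J
    induction J with
    | zero => simp
    | succ J ih =>
      rw [Finset.sum_range_succ, ← Finset.sum_range_add_sum_Ico f
        (Nat.pow_le_pow_right two_pos J.le_succ)]
      linarith [hfg J]
  refine summable_of_sum_range_le (c := f 0 + ∑' j, g j) hf fun n => ?_
  calc ∑ k ∈ Finset.range n, f k ≤ ∑ k ∈ Finset.range (2 ^ n), f k :=
        Finset.sum_le_sum_of_subset_of_nonneg
          (Finset.range_mono Nat.lt_two_pow_self.le) fun k _ _ => hf k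
    _ ≤ f 0 + ∑ j ∈ Finset.range n, g j := hdy n
    _ ≤ _ := by
        gcongr
        exact hg.sum_le_tsum _ fun j _ => hg0 j

theorem summable_one_div_sq_mul_abs_sub_round {α c : ℝ} (hc : 0 < c)
    (h : ∀ k : ℕ, 1 ≤ k → ∀ p : ℤ, c ≤ |k * α - p| ^ 4 * (k : ℝ) ^ 5) :
    Summable fun k : ℕ => 1 / ((k : ℝ) ^ 2 * |k * α - round (k * α)|) := by
  obtain ⟨e, he0, he⟩ : ∃ e : ℝ, 0 < e ∧ e ^ 4 = c :=
    ⟨c ^ ((4 : ℕ)⁻¹ : ℝ), by positivity, Real.rpow_inv_natCast_pow hc.le (by norm_num)⟩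
  obtain ⟨ρ, hρ0, hρ⟩ : ∃ ρ : ℝ, 0 < ρ ∧ ρ ^ 4 = 1 / 2 :=
    ⟨(1 / 2) ^ ((4 : ℕ)⁻¹ : ℝ), by positivity,
      Real.rpow_inv_natCast_pow (by norm_num) (by norm_num)⟩
  have hρ1 : ρ < 1 := by
    by_contra! hge
    have := one_le_pow₀ hge (n := 4)
    rw [hρ] at this
    norm_num at this
  have htwo : ∀ n : ℕ, (2 : ℝ) ^ n = (ρ ^ (4 * n))⁻¹ := by
    intro n; rw [pow_mul, hρ, one_div, inv_pow, inv_inv]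
  have hlow : ∀ j k : ℕ, 1 ≤ k → k ≤ 2 ^ (j + 1) → ∀ p : ℤ,
      e * ρ ^ (5 * (j + 1)) ≤ |k * α - p| := by
    intro j k hk hkj p
    refine le_of_pow_le_pow_left₀ (n := 4) (by norm_num) (abs_nonneg _) ?_
    have h1 : (k : ℝ) ^ 5 ≤ (2 ^ (j + 1)) ^ 5 := by
      gcongr; exact_mod_cast hkj
    have h2 : c ≤ |k * α - p| ^ 4 * (2 ^ (j + 1)) ^ 5 := (h k hk p).trans (by gcongr)
    rw [htwo, inv_pow, ← div_eq_mul_inv, le_div_iff₀ (by positivity)] at h2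
    calc (e * ρ ^ (5 * (j + 1))) ^ 4 = c * (ρ ^ (4 * (j + 1))) ^ 5 := by
          rw [mul_pow, he, ← pow_mul, ← pow_mul]; ring_nf
      _ ≤ _ := h2
  set Z : ℝ := ∑' j : ℤ, 1 / (j : ℝ) ^ 2 with hZ
  have hZ0 : 0 ≤ Z := tsum_nonneg fun j => by positivity
  refine summable_of_sum_dyadic_le (g := fun j => Real.sqrt (4 * Z / (e ^ 2 * ρ ^ 10)) * ρ ^ j)
    (fun n => by positivity) (fun j => ?_)
    ((summable_geometric_of_lt_one hρ0.le hρ1).mul_left _)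
  set s := Finset.Ico (2 ^ j) (2 ^ (j + 1)) with hs
  set x : ℕ → ℝ := fun k => k * α - round (k * α) with hx
  set δ := e * ρ ^ (5 * (j + 1)) with hδ
  have hδ0 : 0 < δ := by positivity
  have hmem : ∀ k ∈ s, 1 ≤ k ∧ 2 ^ j ≤ k ∧ k < 2 ^ (j + 1) := fun k hk => by
    have := Finset.mem_Ico.1 hk
    exact ⟨Nat.one_le_two_pow.trans this.1, this⟩
  have hsep' : ∀ i ∈ s, ∀ k ∈ s, i < k → δ ≤ |x k - x i| := by
    intro i hi k hk hik
    have h1 := hlow j (k - i) (by omega) ((Nat.sub_le _ _).trans (hmem k hk).2.2.le)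
      (round (k * α) - round (i * α))
    refine h1.trans_eq ?_
    rw [hx, Nat.cast_sub hik.le]
    push_cast
    congr 1
    ring
  have hsum := sum_one_div_sq_le_of_separated s x hδ0
    (fun k hk => hlow j k (hmem k hk).1 (hmem k hk).2.2.le _)
    (fun i hi k hk hne => by
      rcases lt_or_gt_of_ne hne with hlt | hlt
      · rw [abs_sub_comm]; exact hsep' i hi k hk hlt
      · exact hsep' k hk i hi hlt)
  have hcs := sq_sum_le_card_mul_sum_sq (s := s) (f := fun k => 1 / |x k|)
  have hcard : (s.card : ℝ) = 2 ^ j := by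
    rw [hs, Nat.card_Ico, pow_succ, mul_two, Nat.add_sub_cancel]; push_cast; rfl
  have hsq : ∀ k, (1 / |x k|) ^ 2 = 1 / x k ^ 2 := fun k => by rw [div_pow, sq_abs, one_pow]
  simp only [hsq, hcard] at hcs
  have hblock : ∑ k ∈ s, 1 / ((k : ℝ) ^ 2 * |x k|) ≤ 1 / (2 ^ j) ^ 2 * ∑ k ∈ s, 1 / |x k| := by
    rw [Finset.mul_sum]
    refine Finset.sum_le_sum fun k hk => ?_
    rw [← one_div_mul_one_div]
    have : (2 ^ j : ℝ) ≤ k := by exact_mod_cast (hmem k hk).2.1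
    gcongr
  refine le_of_pow_le_pow_left₀ two_ne_zero (by positivity) ?_
  calc (∑ k ∈ s, 1 / ((k : ℝ) ^ 2 * |x k|)) ^ 2
      ≤ (1 / (2 ^ j) ^ 2 * ∑ k ∈ s, 1 / |x k|) ^ 2 := by gcongr
    _ = (1 / (2 ^ j) ^ 2) ^ 2 * (∑ k ∈ s, 1 / |x k|) ^ 2 := mul_pow _ _ _
    _ ≤ (1 / (2 ^ j) ^ 2) ^ 2 * (2 ^ j * (4 / δ ^ 2 * Z)) := by
        gcongr
        exact hcs.trans (by gcongr)
    _ = (Real.sqrt (4 * Z / (e ^ 2 * ρ ^ 10)) * ρ ^ j) ^ 2 := by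
        rw [mul_pow (Real.sqrt _), Real.sq_sqrt (by positivity), htwo, hδ]
        field_simp
        ring

end SmallDenominators

section ExponentialSums

theorem norm_sum_Icc_zpow_le {z : ℂ} (hz : ‖z‖ = 1) (hz1 : z ≠ 1) (p q : ℤ) :
    ‖∑ m ∈ Finset.Icc p q, z ^ m‖ ≤ 2 / ‖z - 1‖ := by
  have hz0 : z ≠ 0 := by rintro rfl; simp at hz
  have hpos : 0 < ‖z - 1‖ := norm_pos_iff.2 (sub_ne_zero.2 hz1)
  rw [le_div_iff₀ hpos, ← norm_mul]
  rcases lt_or_ge q p with hlt | hge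
  · simp [Finset.Icc_eq_empty_of_lt hlt]
  · have htel : (∑ m ∈ Finset.Icc p q, z ^ m) * (z - 1) = z ^ (q + 1) - z ^ p := by
      induction q, hge using Int.leInduction with
      | base => simp [zpow_add_one₀ hz0]; ring
      | succ n hn ih =>
        rw [← Finset.insert_Icc_right_eq_Icc_add_one (by omega), Finset.sum_insert (by simp),
          add_mul, ih, zpow_add_one₀ hz0 (n + 1)]
        ring
    rw [htel]
    refine (norm_sub_le _ _).trans ?_
    rw [norm_zpow, norm_zpow, hz]
    norm_num

theorem four_mul_abs_sub_round_le_norm_exp_sub_one (y : ℝ) :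
    4 * |y - round y| ≤ ‖Complex.exp (Complex.I * ((2 * Real.pi * y : ℝ) : ℂ)) - 1‖ := by
  rw [Complex.norm_exp_I_mul_ofReal_sub_one, Real.norm_eq_abs, abs_mul, abs_two]
  have h1 : |Real.sin (2 * Real.pi * y / 2)| = |Real.sin (Real.pi * (y - round y))| := by
    have : Real.pi * (y - round y) = 2 * Real.pi * y / 2 - round y * Real.pi := by ring
    rw [this, Real.sin_sub_int_mul_pi, abs_mul, abs_zpow, abs_neg, abs_one,
      one_zpow, one_mul]
  have h2 := abs_sub_round y
  have h3 : |Real.pi * (y - round y)| ≤ Real.pi / 2 := by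
    rw [abs_mul, abs_of_pos Real.pi_pos]
    nlinarith [Real.pi_pos]
  have h4 := Real.mul_abs_le_abs_sin h3
  rw [h1]
  rw [abs_mul, abs_of_pos Real.pi_pos] at h4
  have : 2 / Real.pi * (Real.pi * |y - round y|) = 2 * |y - round y| := by
    field_simp
  linarith

end ExponentialSums

section FourierDecay

open scoped FourierTransform

theorem intervalIntegral_mul_exp_eq {a b ξ : ℝ} (hab : a ≤ b) (hξ : ξ ≠ 0) {f f' : ℝ → ℂ}
    (hf : ContinuousOn f (Set.Icc a b)) (hff' : ∀ x ∈ Set.Ioo a b, HasDerivAt f (f' x) x)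
    (hf' : IntervalIntegrable f' volume a b) :
    ∫ t in a..b, f t * Complex.exp (Complex.I * ξ * t) =
      (f b * Complex.exp (Complex.I * ξ * b) - f a * Complex.exp (Complex.I * ξ * a) -
        ∫ t in a..b, f' t * Complex.exp (Complex.I * ξ * t)) / (Complex.I * ξ) := by
  have hc : Complex.I * ξ ≠ 0 := mul_ne_zero Complex.I_ne_zero (by exact_mod_cast hξ)
  have hcont : Continuous fun t : ℝ => Complex.exp (Complex.I * ξ * t) := by fun_prop
  have hE : ∀ x : ℝ, HasDerivAt (fun t : ℝ => Complex.exp (Complex.I * ξ * t) / (Complex.I * ξ))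
      (Complex.exp (Complex.I * ξ * x)) x := by
    intro x
    have h1 : HasDerivAt (fun t : ℝ => Complex.I * ξ * (t : ℂ)) (Complex.I * ξ) x := by
      simpa using (Complex.ofRealCLM.hasDerivAt (x := x)).const_mul (Complex.I * ξ)
    simpa [mul_div_assoc, div_self hc] using h1.cexp.div_const (Complex.I * ξ)
  rw [intervalIntegral.integral_mul_deriv_eq_deriv_mul_of_hasDerivAt
    (v := fun t : ℝ => Complex.exp (Complex.I * ξ * t) / (Complex.I * ξ))
    (by rwa [Set.uIcc_of_le hab]) (hcont.div_const _).continuousOn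
    (by simpa [hab] using hff') (fun x _ => hE x) hf' (hcont.intervalIntegrable _ _)]
  simp only [← mul_div_assoc, intervalIntegral.integral_div]
  ring

theorem norm_exp_I_mul_mul (ξ t : ℝ) : ‖Complex.exp (Complex.I * ξ * t)‖ = 1 := by
  rw [mul_assoc, ← Complex.ofReal_mul, mul_comm, Complex.norm_exp_ofReal_mul_I]

theorem eq_zero_at_endpoints {a b : ℝ} {h : ℝ → ℝ} (hcont : Continuous h)
    (hsupp : ∀ x : ℝ, x ∉ Set.Icc a b → h x = 0) : h a = 0 ∧ h b = 0 := by
  have hcl : IsClosed {x | h x = 0} := isClosed_eq hcont continuous_const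
  constructor
  · have := closure_minimal (s := Set.Iio a) (fun x hx => hsupp x fun hx' => not_lt.2 hx'.1 hx) hcl
    rw [closure_Iio] at this
    exact this Set.self_mem_Iic
  · have := closure_minimal (s := Set.Ioi b) (fun x hx => hsupp x fun hx' => not_lt.2 hx'.2 hx) hcl
    rw [closure_Ioi] at this
    exact this Set.self_mem_Ici

theorem exists_lipschitz_extension_deriv {a b : ℝ} {h : ℝ → ℝ}
    (hC2 : ∃ h' h'' : ℝ → ℝ,
      (∀ x ∈ Set.Ioo a b, HasDerivAt h (h' x) x) ∧
      (∀ x ∈ Set.Ioo a b, HasDerivAt h' (h'' x) x) ∧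
      ∃ M : ℝ, ∀ x ∈ Set.Ioo a b, |h'' x| ≤ M) :
    ∃ (K : NNReal) (g : ℝ → ℝ), LipschitzWith K g ∧
      (∀ x ∈ Set.Ioo a b, HasDerivAt h (g x) x) ∧
      ∀ x ∈ Set.Ioo a b, HasDerivAt g (deriv g x) x := by
  obtain ⟨h', h'', hh', hh'', M, hM⟩ := hC2
  have hlip : LipschitzOnWith (Real.toNNReal M) h' (Set.Ioo a b) :=
    (convex_Ioo a b).lipschitzOnWith_of_nnnorm_hasDerivWithin_le
      (fun x hx => (hh'' x hx).hasDerivWithinAt) fun x hx => by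
        rw [← NNReal.coe_le_coe, coe_nnnorm, Real.norm_eq_abs]
        exact (hM x hx).trans (Real.le_coe_toNNReal M)
  obtain ⟨g, hg, hgh⟩ := hlip.extend_real
  refine ⟨_, g, hg, fun x hx => hgh hx ▸ hh' x hx, fun x hx => ?_⟩
  have h1 : HasDerivAt g (h'' x) x := (hh'' x hx).congr_of_eventuallyEq
    (hgh.symm.eventuallyEq_of_mem (Ioo_mem_nhds hx.1 hx.2))
  exact h1.differentiableAt.hasDerivAt

theorem exists_norm_integral_mul_exp_le {a b : ℝ} (hab : a < b) {h : ℝ → ℝ} (hcont : Continuous h)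
    (hsupp : ∀ x : ℝ, x ∉ Set.Icc a b → h x = 0)
    (hC2 : ∃ h' h'' : ℝ → ℝ,
      (∀ x ∈ Set.Ioo a b, HasDerivAt h (h' x) x) ∧
      (∀ x ∈ Set.Ioo a b, HasDerivAt h' (h'' x) x) ∧
      ∃ M : ℝ, ∀ x ∈ Set.Ioo a b, |h'' x| ≤ M) :
    ∃ C : ℝ, ∀ ξ : ℝ, ξ ≠ 0 →
      ‖∫ t in a..b, (h t : ℂ) * Complex.exp (Complex.I * ξ * t)‖ ≤ C / ξ ^ 2 := by
  obtain ⟨ha, hb⟩ := eq_zero_at_endpoints hcont hsupp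
  obtain ⟨K, g, hg, hhg, hgg⟩ := exists_lipschitz_extension_deriv hC2
  refine ⟨|g b| + |g a| + K * |b - a|, fun ξ hξ => ?_⟩
  have hgc : Continuous fun t => (g t : ℂ) := Complex.continuous_ofReal.comp hg.continuous
  have hbound : ∀ x, ‖((deriv g x : ℝ) : ℂ)‖ ≤ K := fun x => by
    rw [Complex.norm_real]; exact norm_deriv_le_of_lipschitz hg
  have hint : IntervalIntegrable (fun x => ((deriv g x : ℝ) : ℂ)) volume a b := by
    refine (intervalIntegrable_const (c := (K : ℝ))).mono_fun ?_ ?_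
    · exact (Complex.measurable_ofReal.comp (measurable_deriv g)).aestronglyMeasurable
    · refine Filter.Eventually.of_forall fun x => ?_
      simpa using hbound x
  rw [intervalIntegral_mul_exp_eq hab.le hξ (f := fun t => (h t : ℂ)) (f' := fun t => (g t : ℂ))
      (Complex.continuous_ofReal.comp hcont).continuousOn
      (fun x hx => (hhg x hx).ofReal_comp) (hgc.intervalIntegrable _ _),
    intervalIntegral_mul_exp_eq hab.le hξ hgc.continuousOn
      (fun x hx => (hgg x hx).ofReal_comp) hint]
  have hnorm : ‖(Complex.I * ξ : ℂ)‖ = |ξ| := by simp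
  have h3 : ‖∫ t in a..b, ((deriv g t : ℝ) : ℂ) * Complex.exp (Complex.I * ξ * t)‖ ≤
      K * |b - a| :=
    intervalIntegral.norm_integral_le_of_norm_le_const fun x _ => by
      rw [norm_mul, norm_exp_I_mul_mul, mul_one]; exact hbound x
  rw [ha, hb]
  simp only [Complex.ofReal_zero, zero_mul, sub_zero, zero_sub, norm_div, norm_neg, hnorm]
  rw [div_div, ← sq, sq_abs]
  gcongr
  refine (norm_sub_le _ _).trans <| add_le_add ((norm_sub_le _ _).trans_eq ?_) h3
  simp only [norm_mul, norm_exp_I_mul_mul, mul_one, Complex.norm_real, Real.norm_eq_abs]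

theorem exists_norm_fourier_comp_div_le {a b s : ℝ} (hab : a < b) (hs : 0 < s) {h : ℝ → ℝ}
    (hcont : Continuous h) (hsupp : ∀ x : ℝ, x ∉ Set.Icc a b → h x = 0)
    (hC2 : ∃ h' h'' : ℝ → ℝ,
      (∀ x ∈ Set.Ioo a b, HasDerivAt h (h' x) x) ∧
      (∀ x ∈ Set.Ioo a b, HasDerivAt h' (h'' x) x) ∧
      ∃ M : ℝ, ∀ x ∈ Set.Ioo a b, |h'' x| ≤ M) :
    ∃ C : ℝ, ∀ y : ℝ, y ≠ 0 → ‖𝓕 (fun x : ℝ => (h (x / s) : ℂ)) y‖ ≤ C / y ^ 2 := by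
  obtain ⟨C, hC⟩ := exists_norm_integral_mul_exp_le hab hcont hsupp hC2
  refine ⟨s * (C / (2 * Real.pi * s) ^ 2), fun y hy => ?_⟩
  have hξ : -(2 * Real.pi * s * y) ≠ 0 := by
    have := Real.pi_pos
    simp only [neg_ne_zero]; positivity
  have key : 𝓕 (fun x : ℝ => (h (x / s) : ℂ)) y =
      s * ∫ t in a..b, (h t : ℂ) * Complex.exp (Complex.I * (-(2 * Real.pi * s * y) : ℝ) * t) := by
    rw [Real.fourier_real_eq_integral_exp_smul]
    have h1 : ∀ v : ℝ, Complex.exp (↑(-2 * Real.pi * v * y) * Complex.I) • (h (v / s) : ℂ) =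
        (fun t : ℝ => (h t : ℂ) * Complex.exp (Complex.I * (-(2 * Real.pi * s * y) : ℝ) * t))
          (v / s) := by
      intro v
      have hs' : (s : ℂ) ≠ 0 := by exact_mod_cast hs.ne'
      rw [smul_eq_mul, mul_comm]
      dsimp only
      congr 2
      push_cast
      field_simp
    simp_rw [h1]
    rw [Measure.integral_comp_div
      (fun t : ℝ => (h t : ℂ) * Complex.exp (Complex.I * (-(2 * Real.pi * s * y) : ℝ) * t)) s,
      abs_of_pos hs, Complex.real_smul, intervalIntegral.integral_eq_integral_of_support_subset]
    intro t ht
    have hht : h t ≠ 0 := fun h0 => ht (by simp [h0])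
    have htI : t ∈ Set.Icc a b := by_contra fun hn => hht (hsupp t hn)
    refine ⟨lt_of_le_of_ne htI.1 ?_, htI.2⟩
    rintro rfl
    exact hht (eq_zero_at_endpoints hcont hsupp).1
  rw [key, norm_mul, Complex.norm_real, Real.norm_eq_abs, abs_of_pos hs, mul_div_assoc]
  gcongr
  refine (hC _ hξ).trans_eq ?_
  rw [neg_sq, mul_pow, div_div]

end FourierDecay

section PoissonSummation

open scoped FourierTransform

theorem fourier_intCast_mul_eq_zpow (k m : ℤ) (α : ℝ) :
    fourier k ((-(m * α) : ℝ) : UnitAddCircle) =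
      Complex.exp (Complex.I * ((2 * Real.pi * (-(k * α)) : ℝ) : ℂ)) ^ m := by
  rw [fourier_coe_apply, ← Complex.exp_int_mul]
  congr 1
  push_cast
  ring

theorem abs_sub_round_neg_eq (y : ℝ) : |-y - round (-y)| = |y - round y| := by
  rw [abs_sub_round_eq_min, abs_sub_round_eq_min]
  by_cases h : Int.fract y = 0
  · have h' : Int.fract (-y) = 0 := Int.fract_neg_eq_zero.2 h
    rw [h, h']
  · rw [Int.fract_neg h, sub_sub_cancel, min_comm]

theorem norm_sum_Icc_fourier_le {α : ℝ} (hα : Irrational α) {k : ℤ} (hk : k ≠ 0) (p q : ℤ) :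
    ‖∑ m ∈ Finset.Icc p q, fourier k ((-(m * α) : ℝ) : UnitAddCircle)‖ ≤
      1 / |k.natAbs * α - round (k.natAbs * α)| := by
  set z := Complex.exp (Complex.I * ((2 * Real.pi * (-(k * α)) : ℝ) : ℂ)) with hz
  have habs : |(k.natAbs : ℝ) * α - round (k.natAbs * α)| =
      |-(k * α) - round (-(k * α) : ℝ)| := by
    rcases Int.natAbs_eq k with h | h
    · have : (k : ℝ) = k.natAbs := (congrArg Int.cast h).trans (Int.cast_natCast _)
      rw [this, abs_sub_round_neg_eq]
    · have : (k : ℝ) = -k.natAbs := by exact_mod_cast h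
      rw [this, neg_mul, neg_neg]
  have hpos : 0 < |(k.natAbs : ℝ) * α - round (k.natAbs * α)| := by
    have h1 : Irrational ((k.natAbs : ℝ) * α) := hα.natCast_mul (Int.natAbs_ne_zero.2 hk)
    exact abs_pos.2 (h1.sub_intCast _).ne_zero
  have hlow := four_mul_abs_sub_round_le_norm_exp_sub_one (-(k * α))
  rw [← habs, ← hz] at hlow
  have hz1 : z ≠ 1 := by
    intro h
    rw [h, sub_self, norm_zero] at hlow
    linarith
  have hzn : ‖z‖ = 1 := by
    rw [hz, mul_comm, Complex.norm_exp_ofReal_mul_I]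
  simp_rw [fourier_intCast_mul_eq_zpow]
  refine (norm_sum_Icc_zpow_le hzn hz1 p q).trans ?_
  rw [div_le_div_iff₀ (by linarith) hpos]
  linarith

theorem exists_abs_sum_tsum_sub_le {α : ℝ} (hα : Irrational α)
    (hsum : Summable fun k : ℕ => 1 / ((k : ℝ) ^ 2 * |k * α - round (k * α)|))
    {H : ℝ → ℝ} (hcont : Continuous H) (hcomp : HasCompactSupport H)
    (hdecay : ∃ C : ℝ, ∀ y : ℝ, y ≠ 0 → ‖𝓕 (fun x : ℝ => (H x : ℂ)) y‖ ≤ C / y ^ 2) :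
    ∃ C : ℝ, ∀ p q : ℤ,
      |∑ m ∈ Finset.Icc p q, ∑' n : ℤ, H (n - m * α) -
        (Finset.Icc p q).card * ∫ x, H x| ≤ C := by
  obtain ⟨C, hC⟩ := hdecay
  set f : ℝ → ℂ := fun x => (H x : ℂ) with hf
  have hfc : Continuous f := Complex.continuous_ofReal.comp hcont
  have hfs : HasCompactSupport f := hcomp.comp_left Complex.ofReal_zero
  have hc0 : 𝓕 f 0 = ((∫ x, H x : ℝ) : ℂ) := by
    rw [Real.fourier_real_eq_integral_exp_smul, ← integral_complex_ofReal]
    simp [hf]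
  have hFsum : Summable fun k : ℤ => 𝓕 f k := by
    refine Summable.of_norm_bounded_eventually (g := fun k : ℤ => C * (1 / (k : ℝ) ^ 2))
      ((Real.summable_one_div_int_pow.2 one_lt_two).mul_left C) ?_
    filter_upwards [(Set.finite_singleton (0 : ℤ)).compl_mem_cofinite] with k hk
    rw [mul_one_div]
    exact hC k (by exact_mod_cast hk)
  have hO : f =O[Filter.cocompact ℝ] fun x : ℝ => |x| ^ (-2 : ℝ) := by
    refine Asymptotics.IsBigO.of_bound 0 ?_
    filter_upwards [hfs.isCompact.compl_mem_cocompact] with x hx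
    rw [image_eq_zero_of_notMem_tsupport hx]
    simp
  have hPoisson : ∀ m : ℤ, ((∑' n : ℤ, H (n - m * α) : ℝ) : ℂ) =
      ∑' k : ℤ, 𝓕 f k * fourier k ((-(m * α) : ℝ) : UnitAddCircle) := by
    intro m
    rw [← Real.tsum_eq_tsum_fourier_of_rpow_decay_of_summable hfc one_lt_two hO hFsum,
      Complex.ofReal_tsum]
    simp only [hf, neg_add_eq_sub]
  have hsm : ∀ m : ℤ, Summable fun k : ℤ =>
      𝓕 f k * fourier k ((-(m * α) : ℝ) : UnitAddCircle) := by
    intro m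
    refine Summable.of_norm ?_
    refine hFsum.norm.congr fun k => ?_
    rw [norm_mul, fourier_apply, Circle.norm_coe, mul_one]
  set w : ℤ → ℝ := fun k =>
    C * (1 / ((k.natAbs : ℝ) ^ 2 * |k.natAbs * α - round (k.natAbs * α)|)) with hw
  have hws : Summable w := by
    refine Summable.mul_left C (Summable.of_nat_of_neg ?_ ?_) <;> simpa using hsum
  refine ⟨∑' k, w k, fun p q => ?_⟩
  set G : ℤ → ℂ := fun k => ∑ m ∈ Finset.Icc p q,
    𝓕 f k * fourier k ((-(m * α) : ℝ) : UnitAddCircle) with hG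
  have hGs : Summable G := summable_sum fun m _ => hsm m
  have hG0 : G 0 = (((Finset.Icc p q).card * ∫ x, H x : ℝ) : ℂ) := by
    simp [hG, hc0]
  have hmain : ((∑ m ∈ Finset.Icc p q, ∑' n : ℤ, H (n - m * α) -
      (Finset.Icc p q).card * ∫ x, H x : ℝ) : ℂ) = ∑' k, if k = 0 then 0 else G k := by
    rw [Complex.ofReal_sub, Complex.ofReal_sum, ← hG0, sub_eq_iff_eq_add',
      ← hGs.tsum_eq_add_tsum_ite 0, hG, Summable.tsum_finsetSum fun m _ => hsm m]
    exact Finset.sum_congr rfl fun m _ => hPoisson m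
  rw [← Real.norm_eq_abs, ← Complex.norm_real, hmain]
  refine tsum_of_norm_bounded hws.hasSum fun k => ?_
  split_ifs with hk
  · simp [hk, hw]
  · have hkR : (k : ℝ) ≠ 0 := by exact_mod_cast hk
    have hsq : ((k.natAbs : ℝ)) ^ 2 = (k : ℝ) ^ 2 := by
      rw [Nat.cast_natAbs, Int.cast_abs, sq_abs]
    simp only [hG, hw]
    rw [← Finset.mul_sum, norm_mul, hsq, ← one_div_mul_one_div, ← mul_assoc, mul_one_div C]
    exact mul_le_mul (hC k hkR) (norm_sum_Icc_fourier_le hα hk p q) (norm_nonneg _)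
      ((norm_nonneg _).trans (hC k hkR))

end PoissonSummation

section Counting

theorem nonneg_of_pos_on_Ioo {a b : ℝ} {h : ℝ → ℝ} (hcont : Continuous h)
    (hsupp : ∀ x : ℝ, x ∉ Set.Icc a b → h x = 0) (hpos : ∀ x ∈ Set.Ioo a b, 0 < h x) (x : ℝ) :
    0 ≤ h x := by
  obtain ⟨ha, hb⟩ := eq_zero_at_endpoints hcont hsupp
  by_cases hx : x ∈ Set.Icc a b
  · rcases Set.eq_endpoints_or_mem_Ioo_of_mem_Icc hx with rfl | rfl | hx
    · exact ha.ge
    · exact hb.ge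
    · exact (hpos x hx).le
  · exact (hsupp x hx).ge

theorem summable_intCast_sub_of_hasCompactSupport {H : ℝ → ℝ} (hH : HasCompactSupport H) (t : ℝ) :
    Summable fun n : ℤ => H (n - t) := by
  have hK : IsCompact ((fun x => x + t) '' tsupport H) := hH.isCompact.image (by fun_prop)
  refine summable_of_hasFiniteSupport
    ((Int.isClosedEmbedding_coe_real.isCompact_preimage hK).finite_of_discrete.subset ?_)
  intro n hn
  exact ⟨n - t, subset_tsupport _ hn, by ring⟩

theorem tsum_ite_mem_ofReal {f : ℤ → ℤ → ℝ} (hf : ∀ m n, 0 ≤ f m n)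
    (hs : ∀ m, Summable (f m)) (S : Finset ℤ) :
    ∑' g : ℤ × ℤ, (if g.1 ∈ S then ENNReal.ofReal (f g.1 g.2) else 0) =
      ENNReal.ofReal (∑ m ∈ S, ∑' n, f m n) := by
  rw [ENNReal.tsum_prod (f := fun m n => if m ∈ S then ENNReal.ofReal (f m n) else 0),
    tsum_eq_sum (s := S) fun m hm => by simp [hm],
    ENNReal.ofReal_sum_of_nonneg fun m _ => tsum_nonneg (hf m)]
  refine Finset.sum_congr rfl fun m hm => ?_
  simp only [hm, if_true]
  exact (ENNReal.ofReal_tsum_of_nonneg (hf m) (hs m)).symm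

theorem card_Icc_ceil_floor_le {x y : ℝ} (hxy : x ≤ y) :
    ((Finset.Icc ⌈x⌉ ⌊y⌋).card : ℝ) ≤ y - x + 1 := by
  have h1 := Int.le_ceil x
  have h2 := Int.floor_le y
  rw [Int.card_Icc]
  rcases le_total 0 (⌊y⌋ + 1 - ⌈x⌉) with h | h
  · have : (((⌊y⌋ + 1 - ⌈x⌉).toNat : ℤ) : ℝ) = ((⌊y⌋ + 1 - ⌈x⌉ : ℤ) : ℝ) := by
      rw [Int.toNat_of_nonneg h]
    push_cast at this
    linarith
  · rw [Int.toNat_of_nonpos h]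
    push_cast
    linarith

theorem le_card_Icc_ceil_floor (x y : ℝ) :
    y - x - 1 ≤ ((Finset.Icc ⌈x⌉ ⌊y⌋).card : ℝ) := by
  have h1 := Int.ceil_lt_add_one x
  have h2 := Int.lt_floor_add_one y
  rw [Int.card_Icc]
  have h3 : ((⌊y⌋ + 1 - ⌈x⌉ : ℤ) : ℝ) ≤ (((⌊y⌋ + 1 - ⌈x⌉).toNat : ℤ) : ℝ) := by
    exact_mod_cast Int.self_le_toNat _
  push_cast at h3
  linarith

end Counting

/-- The weighted `1×1` cut-and-project Dirac comb `ω = ∑_{g ∈ ℤ²} h(⟨g,v⟩)·δ_{⟨g,u⟩}`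
with a continuous weight function `h` supported on the window `[a,b]` that is twice
differentiable on `(a,b)` with uniformly bounded second derivative is bounded distance
equivalent to `m·λ` with `m = ∫_a^b h`. -/
theorem weightedCPS_bddDist_of_twiceDifferentiable
    (α : ℝ) (hα : Irrational α) (hαpos : 0 < α) (hstar : CondStar α)
    (a b : ℝ) (hab : a < b)
    (h : ℝ → ℝ) (hcont : Continuous h)
    (hsupp : ∀ x : ℝ, x ∉ Set.Icc a b → h x = 0)
    (hpos : ∀ x ∈ Set.Ioo a b, 0 < h x)
    (hC2 : ∃ h' h'' : ℝ → ℝ,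
      (∀ x ∈ Set.Ioo a b, HasDerivAt h (h' x) x) ∧
      (∀ x ∈ Set.Ioo a b, HasDerivAt h' (h'' x) x) ∧
      ∃ M : ℝ, ∀ x ∈ Set.Ioo a b, |h'' x| ≤ M)
    (u v : ℝ × ℝ)
    (hu : u = (1 / Real.sqrt (1 + α ^ 2), α / Real.sqrt (1 + α ^ 2)))
    (hv : v = (-α / Real.sqrt (1 + α ^ 2), 1 / Real.sqrt (1 + α ^ 2)))
    (ω : Measure ℝ)
    (hω : ω = Measure.sum (fun g : ℤ × ℤ =>
      ENNReal.ofReal (h ((g.1 : ℝ) * v.1 + (g.2 : ℝ) * v.2)) •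
        Measure.dirac ((g.1 : ℝ) * u.1 + (g.2 : ℝ) * u.2))) :
    BddDistMeasures ω (ENNReal.ofReal (∫ t in a..b, h t) • (volume : Measure ℝ)) := by
  subst hu hv
  set s := Real.sqrt (1 + α ^ 2) with hs
  have hs0 : 0 < s := Real.sqrt_pos.2 (by positivity)
  have hs2 : s ^ 2 = 1 + α ^ 2 := Real.sq_sqrt (by positivity)
  have hnonneg := nonneg_of_pos_on_Ioo hcont hsupp hpos
  set H : ℝ → ℝ := fun x => h (x / s) with hH
  have hHc : Continuous H := hcont.comp (continuous_id.div_const s)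
  have hHs : HasCompactSupport H := by
    refine HasCompactSupport.intro (isCompact_Icc (a := s * a) (b := s * b)) fun x hx => ?_
    refine hsupp _ fun hx' => hx ⟨?_, ?_⟩
    · have := (le_div_iff₀ hs0).1 hx'.1
      linarith
    · have := (div_le_iff₀ hs0).1 hx'.2
      linarith
  obtain ⟨c, hc, hdioph⟩ := hstar.exists_le_abs_mul_sub_pow hα
  obtain ⟨C, hC⟩ := exists_abs_sum_tsum_sub_le hα
    (summable_one_div_sq_mul_abs_sub_round hc hdioph) hHc hHs
    (exists_norm_fourier_comp_div_le hab hs0 hcont hsupp hC2)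
  set J := ∫ t in a..b, h t with hJ
  have hJ0 : 0 ≤ J := intervalIntegral.integral_nonneg hab.le fun t _ => hnonneg t
  have hHint : ∫ x, H x = s * J := by
    rw [hH, Measure.integral_comp_div h s, abs_of_pos hs0, smul_eq_mul, hJ,
      intervalIntegral.integral_eq_integral_of_support_subset]
    intro t ht
    have htI : t ∈ Set.Icc a b := by_contra fun hn => ht (hsupp t hn)
    refine ⟨lt_of_le_of_ne htI.1 ?_, htI.2⟩
    rintro rfl
    exact ht (eq_zero_at_endpoints hcont hsupp).1
  rw [hHint] at hC
  have hC0 : 0 ≤ C := (abs_nonneg _).trans (hC 0 0)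
  set R := α * max |a| |b| with hR
  have hR0 : 0 ≤ R := by positivity
  have hsumm : ∀ m : ℤ, Summable fun n : ℤ => H (n - m * α) := fun m =>
    summable_intCast_sub_of_hasCompactSupport hHs _
  have hHn : ∀ x, 0 ≤ H x := fun x => hnonneg _
  have harg : ∀ g : ℤ × ℤ, h ((g.1 : ℝ) * (-α / s) + (g.2 : ℝ) * (1 / s)) =
      H (g.2 - g.1 * α) := fun g => by
    rw [hH]; congr 1; ring
  have hloc : ∀ g : ℤ × ℤ, H (g.2 - g.1 * α) ≠ 0 →
      |(g.1 : ℝ) * (1 / s) + (g.2 : ℝ) * (α / s) - g.1 * s| ≤ R := by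
    intro g hg
    set x := ((g.2 : ℝ) - g.1 * α) / s with hx
    have hxI : x ∈ Set.Icc a b := by_contra fun hn => hg (hsupp _ hn)
    have h1 : (g.1 : ℝ) * (1 / s) + (g.2 : ℝ) * (α / s) - g.1 * s = α * x := by
      rw [hx]
      field_simp
      rw [hs2]
      ring
    rw [h1, abs_mul, abs_of_pos hαpos]
    exact mul_le_mul_of_nonneg_left (abs_le_max_abs_abs hxI.1 hxI.2) hαpos.le
  refine ⟨C + s * J * (2 * R / s + 1) + 1, by positivity, fun x y hxy => ?_⟩
  have hν : ((ENNReal.ofReal J • (volume : Measure ℝ)) (Set.Icc x y)).toReal =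
      s * J * ((y - x) / s) := by
    rw [Measure.smul_apply, smul_eq_mul, Real.volume_Icc, ENNReal.toReal_mul,
      ENNReal.toReal_ofReal hJ0, ENNReal.toReal_ofReal (by linarith)]
    field_simp
  have hω' : ω (Set.Icc x y) = ∑' g : ℤ × ℤ, ENNReal.ofReal (H (g.2 - g.1 * α)) *
      (Set.Icc x y).indicator 1 ((g.1 : ℝ) * (1 / s) + (g.2 : ℝ) * (α / s)) := by
    rw [hω, Measure.sum_apply _ measurableSet_Icc]
    refine tsum_congr fun g => ?_
    rw [Measure.smul_apply, Measure.dirac_apply' _ measurableSet_Icc, smul_eq_mul, harg]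
  have hupper : ω (Set.Icc x y) ≤ ENNReal.ofReal
      (∑ m ∈ Finset.Icc ⌈(x - R) / s⌉ ⌊(y + R) / s⌋, ∑' n : ℤ, H (n - m * α)) := by
    rw [hω', ← tsum_ite_mem_ofReal (fun m n => hHn _) hsumm]
    refine ENNReal.tsum_le_tsum fun g => ?_
    by_cases hg : H (g.2 - g.1 * α) = 0
    · simp [hg]
    · have hl := abs_le.1 (hloc g hg)
      by_cases hmem : (g.1 : ℝ) * (1 / s) + (g.2 : ℝ) * (α / s) ∈ Set.Icc x y
      · rw [if_pos, Set.indicator_of_mem hmem, Pi.one_apply, mul_one]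
        rw [Finset.mem_Icc, Int.ceil_le, Int.le_floor, div_le_iff₀ hs0, le_div_iff₀ hs0]
        exact ⟨by linarith [hmem.1], by linarith [hmem.2]⟩
      · rw [Set.indicator_of_notMem hmem, mul_zero]
        exact zero_le
  have hlower : ENNReal.ofReal (∑ m ∈ Finset.Icc ⌈(x + R) / s⌉ ⌊(y - R) / s⌋,
      ∑' n : ℤ, H (n - m * α)) ≤ ω (Set.Icc x y) := by
    rw [hω', ← tsum_ite_mem_ofReal (fun m n => hHn _) hsumm]
    refine ENNReal.tsum_le_tsum fun g => ?_
    by_cases hg : H (g.2 - g.1 * α) = 0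
    · simp [hg]
    · have hl := abs_le.1 (hloc g hg)
      split_ifs with hmem
      · rw [Finset.mem_Icc, Int.ceil_le, Int.le_floor, div_le_iff₀ hs0, le_div_iff₀ hs0] at hmem
        rw [Set.indicator_of_mem, Pi.one_apply, mul_one]
        exact ⟨by linarith [hmem.1], by linarith [hmem.2]⟩
      · exact zero_le
  have hnn : ∀ p q : ℤ, 0 ≤ ∑ m ∈ Finset.Icc p q, ∑' n : ℤ, H (n - m * α) := fun p q =>
    Finset.sum_nonneg fun m _ => tsum_nonneg fun n => hHn _
  have hup := ENNReal.toReal_mono ENNReal.ofReal_ne_top hupper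
  have hlo := ENNReal.toReal_mono (hupper.trans_lt ENNReal.ofReal_lt_top).ne hlower
  rw [ENNReal.toReal_ofReal (hnn _ _)] at hup hlo
  have hCu := abs_le.1 (hC ⌈(x - R) / s⌉ ⌊(y + R) / s⌋)
  have hCl := abs_le.1 (hC ⌈(x + R) / s⌉ ⌊(y - R) / s⌋)
  have hcu := card_Icc_ceil_floor_le (x := (x - R) / s) (y := (y + R) / s) (by gcongr; linarith)
  have hcl := le_card_Icc_ceil_floor ((x + R) / s) ((y - R) / s)
  have hsJ : 0 ≤ s * J := by positivity
  have hcu' := mul_le_mul_of_nonneg_left hcu hsJ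
  have hcl' := mul_le_mul_of_nonneg_left hcl hsJ
  have e1 : s * J * ((y + R) / s - (x - R) / s + 1) =
      s * J * ((y - x) / s) + s * J * (2 * R / s + 1) := by ring
  have e2 : s * J * ((y - R) / s - (x + R) / s - 1) =
      s * J * ((y - x) / s) - s * J * (2 * R / s + 1) := by ring
  rw [hν, abs_lt]
  constructor <;> linarith
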